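/- arXiv:1709.01445 — 4 statements merged into one kernel-verified Lean document; each statement's English description precedes it below -/
import Mathlib

section
/- Let q ≥ 1 and n ≥ 1. Let W be an invertible 2q×2q real matrix, let B̃ be an n×2q real matrix, and write B̃W = (B₀* B₁*) where B₀* and B₁* are the n×q blocks of columns of B̃W. Let R be an n×n real symmetric positive definite matrix and set P̃ = W · diag(I_q, 0_q) · Wᵀ. Then: (i) B̃ P̃ B̃ᵀ = B₀* B₀*ᵀ, so B̃ P̃ B̃ᵀ + R is positive definite, hence invertible; and (ii) diag(I_q, 0_q) · Wᵀ B̃ᵀ (B̃ P̃ B̃ᵀ + R)⁻¹ B̃ W · diag(I_q, 0_q) equals the 2q×2q block-diagonal matrix diag( (B₀*ᵀ R⁻¹ B₀* + I_q)⁻¹ B₀*ᵀ R⁻¹ B₀* , 0_q ). -/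
open Matrix

/-- Block computation (eqs. eq:PWtilde1, eq:PWtilde2, eq:PWtilde4) from the proof of
Lemma C.3 of the paper. Here the `2q`-dimensional index set is `Fin q ⊕ Fin q`,
`J = diag(I_q, 0_q)`, `P̃ = W J Wᵀ`, and `B₀*`, `B₁*` are the two `n × q` column blocks of
`B̃ W`. Then `B̃ P̃ B̃ᵀ = B₀* B₀*ᵀ` (so `B̃ P̃ B̃ᵀ + R` is positive definite, hence invertible)
and `J Wᵀ B̃ᵀ (B̃ P̃ B̃ᵀ + R)⁻¹ B̃ W J = diag((B₀*ᵀ R⁻¹ B₀* + I_q)⁻¹ B₀*ᵀ R⁻¹ B₀*, 0_q)`. -/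
theorem stmt_7 {q n : ℕ} (hq : 1 ≤ q) (hn : 1 ≤ n)
    (W : Matrix (Fin q ⊕ Fin q) (Fin q ⊕ Fin q) ℝ) (hW : IsUnit W.det)
    (Btil : Matrix (Fin n) (Fin q ⊕ Fin q) ℝ)
    (R : Matrix (Fin n) (Fin n) ℝ) (hR : R.PosDef)
    (J : Matrix (Fin q ⊕ Fin q) (Fin q ⊕ Fin q) ℝ)
    (hJ : J = Matrix.fromBlocks (1 : Matrix (Fin q) (Fin q) ℝ) 0 0 0)
    (Ptil : Matrix (Fin q ⊕ Fin q) (Fin q ⊕ Fin q) ℝ) (hPtil : Ptil = W * J * Wᵀ)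
    (B₀ B₁ : Matrix (Fin n) (Fin q) ℝ)
    (hB₀ : B₀ = (Btil * W).submatrix id Sum.inl)
    (hB₁ : B₁ = (Btil * W).submatrix id Sum.inr) :
    Btil * Ptil * Btilᵀ = B₀ * B₀ᵀ ∧ (Btil * Ptil * Btilᵀ + R).PosDef ∧
      J * Wᵀ * Btilᵀ * (Btil * Ptil * Btilᵀ + R)⁻¹ * Btil * W * J =
        Matrix.fromBlocks ((B₀ᵀ * R⁻¹ * B₀ + 1)⁻¹ * (B₀ᵀ * R⁻¹ * B₀)) 0 0 0 := by
  have hM : Btil * W = fromCols B₀ B₁ := by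
    subst hB₀ hB₁
    ext i (j | j) <;> simp
  have hMJ : Btil * W * J = fromCols B₀ 0 := by
    rw [hM, hJ, fromCols_mul_fromBlocks]; simp
  have hJT : Jᵀ = J := by
    rw [hJ, fromBlocks_transpose]; simp
  have hJM : J * Wᵀ * Btilᵀ = fromRows B₀ᵀ 0 := by
    have h := congrArg Matrix.transpose hMJ
    rw [transpose_fromCols, transpose_mul, transpose_mul, hJT] at h
    rw [Matrix.mul_assoc, h]; simp
  have h1 : Btil * Ptil * Btilᵀ = B₀ * B₀ᵀ := by
    have : Btil * Ptil * Btilᵀ = Btil * W * (J * Wᵀ * Btilᵀ) := by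
      rw [hPtil]; simp only [Matrix.mul_assoc]
    rw [this, hJM, hM, fromCols_mul_fromRows]; simp
  have hBB : (B₀ * B₀ᵀ).PosSemidef := by
    simpa using posSemidef_self_mul_conjTranspose B₀
  have h2 : (B₀ * B₀ᵀ + R).PosDef := PosDef.posSemidef_add hBB hR
  have hRd : IsUnit R.det := (isUnit_iff_isUnit_det _).1 hR.isUnit
  have hSd : IsUnit (B₀ * B₀ᵀ + R).det := (isUnit_iff_isUnit_det _).1 h2.isUnit
  have hG : (B₀ᵀ * R⁻¹ * B₀ + 1).PosDef := by
    refine PosDef.posSemidef_add ?_ PosDef.one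
    simpa using hR.inv.posSemidef.conjTranspose_mul_mul_same B₀
  have hGd : IsUnit (B₀ᵀ * R⁻¹ * B₀ + 1).det := (isUnit_iff_isUnit_det _).1 hG.isUnit
  refine ⟨h1, h1 ▸ h2, ?_⟩
  rw [h1]
  generalize hS : B₀ * B₀ᵀ + R = S at *
  have h3 : (B₀ᵀ * R⁻¹ * B₀ + 1) * B₀ᵀ = B₀ᵀ * R⁻¹ * S := by
    rw [← hS, Matrix.add_mul, Matrix.mul_add, Matrix.one_mul, Matrix.mul_assoc B₀ᵀ R⁻¹ R,
      nonsing_inv_mul _ hRd, Matrix.mul_one, Matrix.mul_assoc (B₀ᵀ * R⁻¹)]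
  have h4 : (B₀ᵀ * R⁻¹ * B₀ + 1) * (B₀ᵀ * S⁻¹) = B₀ᵀ * R⁻¹ := by
    rw [← Matrix.mul_assoc, h3, Matrix.mul_assoc, mul_nonsing_inv _ hSd, Matrix.mul_one]
  have h5 : B₀ᵀ * S⁻¹ * B₀ = (B₀ᵀ * R⁻¹ * B₀ + 1)⁻¹ * (B₀ᵀ * R⁻¹ * B₀) := by
    have h7 := nonsing_inv_mul_cancel_left _ (B₀ᵀ * S⁻¹) hGd
    rw [h4] at h7
    rw [← h7, Matrix.mul_assoc]
  have h6 : J * Wᵀ * Btilᵀ * S⁻¹ * Btil * W * J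
      = (J * Wᵀ * Btilᵀ) * S⁻¹ * (Btil * W * J) := by
    simp only [Matrix.mul_assoc]
  rw [h6, hJM, hMJ, ← h5, fromRows_mul, fromRows_mul_fromCols]
  simp
end

section
/- With the Kalman filter recursions as defined in the context, define for t = 1,…,T the matrix L_t = A − A P_{t|t−1} Λᵀ (Λ P_{t|t−1} Λᵀ + R)⁻¹ Λ, and the backward recursion r_T = 0, r_{t−1} = Λᵀ (Λ P_{t|t−1} Λᵀ + R)⁻¹ (x_t − Λ F_{t|t−1}) + L_tᵀ r_t for t = T, T−1, …, 1; set F^B_{t|T} = F_{t|t−1} + P_{t|t−1} r_{t−1} for t = 1,…,T. Assume additionally that P_{t+1|t} is invertible for every t = 1,…,T−1, and define the backward recursion F^A_{T|T} = F_{T|T} and F^A_{t|T} = F_{t|t} + P_{t|t} Aᵀ (P_{t+1|t})⁻¹ (F^A_{t+1|T} − F_{t+1|t}) for t = T−1,…,1. Then F^A_{t|T} = F^B_{t|T} for every t = 1,…,T. -/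
open Matrix

/-- Equivalence of the classical fixed-interval smoother recursion (eq:KS1) with the
inversion-free backward recursion (eq:KS3)–(eq:KS4) with gains (eq:KS7), Appendix B.2.2 of
the paper. The Kalman filter recursions (over `t = 1,…,T`) are encoded as hypotheses:
`Fpred t = F_{t|t−1}`, `Ppred t = P_{t|t−1}`, `Ffilt t = F_{t|t}`, `Pfilt t = P_{t|t}`.
`FA` is the classical smoother (requiring each `P_{t+1|t}` invertible) and `FB` is the
inversion-free smoother; the conclusion is `FA t = FB t` for all `t = 1,…,T`. -/
theorem stmt_9 {n r q : ℕ} (T : ℕ) (hT : 1 ≤ T)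
    (x : ℕ → Fin n → ℝ)
    (A : Matrix (Fin r) (Fin r) ℝ) (Λ : Matrix (Fin n) (Fin r) ℝ)
    (H : Matrix (Fin r) (Fin q) ℝ)
    (R : Matrix (Fin n) (Fin n) ℝ) (hR : R.PosDef)
    (F0 : Fin r → ℝ) (P0 : Matrix (Fin r) (Fin r) ℝ) (hP0 : P0.PosSemidef)
    (Fpred Ffilt : ℕ → Fin r → ℝ) (Ppred Pfilt : ℕ → Matrix (Fin r) (Fin r) ℝ)
    (hFfilt0 : Ffilt 0 = F0) (hPfilt0 : Pfilt 0 = P0)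
    (hFpred : ∀ t, 1 ≤ t → t ≤ T → Fpred t = A *ᵥ Ffilt (t - 1))
    (hPpred : ∀ t, 1 ≤ t → t ≤ T → Ppred t = A * Pfilt (t - 1) * Aᵀ + H * Hᵀ)
    (hFfilt : ∀ t, 1 ≤ t → t ≤ T →
      Ffilt t = Fpred t +
        (Ppred t * Λᵀ * (Λ * Ppred t * Λᵀ + R)⁻¹) *ᵥ (x t - Λ *ᵥ Fpred t))
    (hPfilt : ∀ t, 1 ≤ t → t ≤ T →
      Pfilt t = Ppred t - Ppred t * Λᵀ * (Λ * Ppred t * Λᵀ + R)⁻¹ * Λ * Ppred t)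
    (L : ℕ → Matrix (Fin r) (Fin r) ℝ)
    (hL : ∀ t, 1 ≤ t → t ≤ T →
      L t = A - A * Ppred t * Λᵀ * (Λ * Ppred t * Λᵀ + R)⁻¹ * Λ)
    (rv : ℕ → Fin r → ℝ) (hrvT : rv T = 0)
    (hrv : ∀ t, 1 ≤ t → t ≤ T →
      rv (t - 1) = (Λᵀ * (Λ * Ppred t * Λᵀ + R)⁻¹) *ᵥ (x t - Λ *ᵥ Fpred t) +
        (L t)ᵀ *ᵥ rv t)
    (FB : ℕ → Fin r → ℝ)
    (hFB : ∀ t, 1 ≤ t → t ≤ T → FB t = Fpred t + Ppred t *ᵥ rv (t - 1))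
    (hinv : ∀ t, 1 ≤ t → t ≤ T - 1 → IsUnit (Ppred (t + 1)).det)
    (FA : ℕ → Fin r → ℝ) (hFAT : FA T = Ffilt T)
    (hFA : ∀ t, 1 ≤ t → t ≤ T - 1 →
      FA t = Ffilt t +
        (Pfilt t * Aᵀ * (Ppred (t + 1))⁻¹) *ᵥ (FA (t + 1) - Fpred (t + 1))) :
    ∀ t, 1 ≤ t → t ≤ T → FA t = FB t := by
  have hRs : Rᵀ = R := by
    have := hR.isHermitian
    simpa [Matrix.IsHermitian, Matrix.conjTranspose_eq_transpose_of_trivial] using this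
  have hP0s : P0ᵀ = P0 := by
    have := hP0.isHermitian
    simpa [Matrix.IsHermitian, Matrix.conjTranspose_eq_transpose_of_trivial] using this
  have hpp : ∀ t, 1 ≤ t → t ≤ T → (Pfilt (t - 1))ᵀ = Pfilt (t - 1) →
      (Ppred t)ᵀ = Ppred t := by
    intro t h1 h2 h
    rw [hPpred t h1 h2]
    simp only [Matrix.transpose_add, Matrix.transpose_mul, Matrix.transpose_transpose, h,
      Matrix.mul_assoc]
  have hSs : ∀ t, (Ppred t)ᵀ = Ppred t →
      ((Λ * Ppred t * Λᵀ + R)⁻¹)ᵀ = (Λ * Ppred t * Λᵀ + R)⁻¹ := by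
    intro t h
    rw [Matrix.transpose_nonsing_inv]
    simp only [Matrix.transpose_add, Matrix.transpose_mul, Matrix.transpose_transpose, h,
      Matrix.mul_assoc, hRs]
  have hfs : ∀ t, t ≤ T → (Pfilt t)ᵀ = Pfilt t := by
    intro t
    induction t with
    | zero => intro _; rw [hPfilt0, hP0s]
    | succ k ih =>
      intro h
      have hp := hpp (k + 1) (by omega) h (by simpa using ih (by omega))
      have hS := hSs (k + 1) hp
      rw [hPfilt (k + 1) (by omega) h]
      generalize (Λ * Ppred (k + 1) * Λᵀ + R)⁻¹ = S at hS ⊢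
      simp only [Matrix.transpose_sub, Matrix.transpose_mul, Matrix.transpose_transpose, hp, hS,
        Matrix.mul_assoc]
  have key : ∀ t, 1 ≤ t → t ≤ T → FB t = Ffilt t + (Pfilt t * Aᵀ) *ᵥ rv t := by
    intro t h1 h2
    have hp := hpp t h1 h2 (hfs _ (by omega))
    have hS := hSs t hp
    have hPL : Ppred t * (L t)ᵀ = Pfilt t * Aᵀ := by
      rw [hL t h1 h2, hPfilt t h1 h2]
      generalize (Λ * Ppred t * Λᵀ + R)⁻¹ = S at hS ⊢
      simp only [Matrix.transpose_sub, Matrix.transpose_mul, Matrix.transpose_transpose, hp, hS,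
        Matrix.mul_assoc, Matrix.mul_sub, Matrix.sub_mul]
    rw [hFB t h1 h2, hrv t h1 h2, hFfilt t h1 h2, Matrix.mulVec_add, Matrix.mulVec_mulVec,
      Matrix.mulVec_mulVec, hPL, Matrix.mul_assoc (Ppred t), add_assoc]
  intro t h1 h2
  induction h2 using Nat.decreasingInduction with
  | self => rw [hFAT, key T hT le_rfl, hrvT, Matrix.mulVec_zero, add_zero]
  | of_succ k hk ih =>
    have ih' := ih (by omega)
    rw [hFA k h1 (by omega), ih', hFB (k + 1) (by omega) hk, key k h1 (by omega),
      add_sub_cancel_left, Matrix.mulVec_mulVec, Nat.add_sub_cancel,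
      Matrix.mul_assoc _ (Ppred (k + 1))⁻¹, Matrix.nonsing_inv_mul _ (hinv k h1 (by omega)),
      Matrix.mul_one]
end

section
/- With the Kalman filter recursions as defined in the context, define for t = 1,…,T the matrix L_t = A − A P_{t|t−1} Λᵀ (Λ P_{t|t−1} Λᵀ + R)⁻¹ Λ, and the backward recursion N_T = 0, N_{t−1} = Λᵀ (Λ P_{t|t−1} Λᵀ + R)⁻¹ Λ + L_tᵀ N_t L_t for t = T, T−1, …, 1; set P^B_{t|T} = P_{t|t−1} − P_{t|t−1} N_{t−1} P_{t|t−1} for t = 1,…,T. Assume additionally that P_{t+1|t} is invertible for every t = 1,…,T−1, and define the backward recursion P^A_{T|T} = P_{T|T} and P^A_{t|T} = P_{t|t} + P_{t|t} Aᵀ (P_{t+1|t})⁻¹ (P^A_{t+1|T} − P_{t+1|t}) (P_{t+1|t})⁻¹ A P_{t|t} for t = T−1,…,1. Then P^A_{t|T} = P^B_{t|T} for every t = 1,…,T. -/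
open Matrix

/-- Equivalence of the classical fixed-interval smoother recursion (eq:KS2) for the smoothed
error covariances with the inversion-free backward recursion (eq:KS5)–(eq:KS6) with gains
(eq:KS7), Appendix B.2.2 of the paper. The Kalman filter covariance recursions (over
`t = 1,…,T`) are encoded as hypotheses: `Ppred t = P_{t|t−1}` and `Pfilt t = P_{t|t}`.
`PA` is the classical smoother recursion (requiring each `P_{t+1|t}` invertible) and `PB`
is the inversion-free one; the conclusion is `PA t = PB t` for all `t = 1,…,T`. -/
theorem stmt_10 {n r q : ℕ} (T : ℕ) (hT : 1 ≤ T)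
    (A : Matrix (Fin r) (Fin r) ℝ) (Λ : Matrix (Fin n) (Fin r) ℝ)
    (H : Matrix (Fin r) (Fin q) ℝ)
    (R : Matrix (Fin n) (Fin n) ℝ) (hR : R.PosDef)
    (P0 : Matrix (Fin r) (Fin r) ℝ) (hP0 : P0.PosSemidef)
    (Ppred Pfilt : ℕ → Matrix (Fin r) (Fin r) ℝ)
    (hPfilt0 : Pfilt 0 = P0)
    (hPpred : ∀ t, 1 ≤ t → t ≤ T → Ppred t = A * Pfilt (t - 1) * Aᵀ + H * Hᵀ)
    (hPfilt : ∀ t, 1 ≤ t → t ≤ T →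
      Pfilt t = Ppred t - Ppred t * Λᵀ * (Λ * Ppred t * Λᵀ + R)⁻¹ * Λ * Ppred t)
    (L : ℕ → Matrix (Fin r) (Fin r) ℝ)
    (hL : ∀ t, 1 ≤ t → t ≤ T →
      L t = A - A * Ppred t * Λᵀ * (Λ * Ppred t * Λᵀ + R)⁻¹ * Λ)
    (N : ℕ → Matrix (Fin r) (Fin r) ℝ) (hNT : N T = 0)
    (hN : ∀ t, 1 ≤ t → t ≤ T →
      N (t - 1) = Λᵀ * (Λ * Ppred t * Λᵀ + R)⁻¹ * Λ + (L t)ᵀ * N t * L t)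
    (PB : ℕ → Matrix (Fin r) (Fin r) ℝ)
    (hPB : ∀ t, 1 ≤ t → t ≤ T → PB t = Ppred t - Ppred t * N (t - 1) * Ppred t)
    (hinv : ∀ t, 1 ≤ t → t ≤ T - 1 → IsUnit (Ppred (t + 1)).det)
    (PA : ℕ → Matrix (Fin r) (Fin r) ℝ) (hPAT : PA T = Pfilt T)
    (hPA : ∀ t, 1 ≤ t → t ≤ T - 1 →
      PA t = Pfilt t +
        Pfilt t * Aᵀ * (Ppred (t + 1))⁻¹ * (PA (t + 1) - Ppred (t + 1)) *
          (Ppred (t + 1))⁻¹ * A * Pfilt t) :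
    ∀ t, 1 ≤ t → t ≤ T → PA t = PB t := by
  have hRs : Rᵀ = R := by
    have := hR.1
    rwa [IsHermitian, conjTranspose_eq_transpose_of_trivial] at this
  have hP0s : P0ᵀ = P0 := by
    have := hP0.1
    rwa [IsHermitian, conjTranspose_eq_transpose_of_trivial] at this
  have hpred : ∀ t, 1 ≤ t → t ≤ T → (Pfilt (t - 1))ᵀ = Pfilt (t - 1) →
      (Ppred t)ᵀ = Ppred t := by
    intro t h1 h2 h
    rw [hPpred t h1 h2]
    simp [transpose_mul, h, Matrix.mul_assoc]
  have hfs : ∀ t, 1 ≤ t → t ≤ T → (Ppred t)ᵀ = Ppred t → (Pfilt t)ᵀ = Pfilt t := by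
    intro t h1 h2 h
    rw [hPfilt t h1 h2]
    simp [transpose_mul, transpose_nonsing_inv, h, hRs, Matrix.mul_assoc]
  have hF : ∀ t, t ≤ T → (Pfilt t)ᵀ = Pfilt t := by
    intro t
    induction t with
    | zero => intro _; rw [hPfilt0, hP0s]
    | succ k ih =>
      intro h
      exact hfs _ (by omega) h (hpred _ (by omega) h (by simpa using ih (by omega)))
  have hP : ∀ t, 1 ≤ t → t ≤ T → (Ppred t)ᵀ = Ppred t :=
    fun t h1 h2 => hpred t h1 h2 (hF _ (by omega))
  have hLP : ∀ t, 1 ≤ t → t ≤ T → L t * Ppred t = A * Pfilt t := by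
    intro t h1 h2
    rw [hL t h1 h2, hPfilt t h1 h2]
    simp only [Matrix.sub_mul, Matrix.mul_sub, Matrix.mul_assoc]
  have hPL : ∀ t, 1 ≤ t → t ≤ T → Ppred t * (L t)ᵀ = Pfilt t * Aᵀ := by
    intro t h1 h2
    have := congrArg transpose (hLP t h1 h2)
    rwa [transpose_mul, transpose_mul, hP t h1 h2, hF t h2] at this
  have hB : ∀ t, 1 ≤ t → t ≤ T → PB t = Pfilt t - Pfilt t * Aᵀ * N t * (A * Pfilt t) := by
    intro t h1 h2
    rw [hPB t h1 h2, hN t h1 h2, ← hLP t h1 h2, ← hPL t h1 h2, hPfilt t h1 h2]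
    simp only [Matrix.add_mul, Matrix.mul_add, Matrix.mul_assoc]
    abel
  intro t h1 h2
  induction h2 using Nat.decreasingInduction with
  | self => rw [hPAT, hB T hT le_rfl, hNT]; simp
  | of_succ k hk ih =>
    have hu := hinv k h1 (by omega)
    rw [hPA k h1 (by omega), ih (by omega), hPB (k+1) (by omega) hk, hB k h1 (by omega)]
    have e : (Ppred (k + 1))⁻¹ * (Ppred (k + 1) - Ppred (k + 1) * N (k + 1 - 1) * Ppred (k + 1)
        - Ppred (k + 1)) * (Ppred (k + 1))⁻¹ = - N k := by
      rw [sub_sub_cancel_left, Matrix.mul_neg, Matrix.neg_mul, Nat.add_sub_cancel,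
        Matrix.mul_assoc (Ppred (k+1)), Matrix.nonsing_inv_mul_cancel_left _ _ hu,
        Matrix.mul_nonsing_inv_cancel_right _ _ hu]
    rw [Matrix.mul_assoc (Pfilt k * Aᵀ), Matrix.mul_assoc (Pfilt k * Aᵀ), e]
    simp only [Matrix.mul_neg, Matrix.neg_mul, Matrix.mul_assoc]
    abel
end

section
/- Let (Z, 𝒜, μ) be a measure space. For i = 1, 2 let f_i : Z → [0,∞) be measurable with 0 < L_i < ∞, where L_i := ∫ f_i dμ. Set p₁ := f₁ / L₁. Assume that f₂ > 0 μ-almost everywhere on the set {f₁ > 0}, and that the functions p₁·log f₁ and p₁·log f₂ (with the convention 0·log 0 = 0) are μ-integrable. If ∫ p₁ log f₂ dμ ≥ ∫ p₁ log f₁ dμ, then log L₂ ≥ log L₁ (equivalently L₂ ≥ L₁). -/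
open MeasureTheory

/-- Ascent property of the EM algorithm, Appendix B.1.4 of the paper: with
`L_i = ∫ f_i dμ ∈ (0, ∞)` and `p₁ = f₁ / L₁`, if `f₂ > 0` a.e. on `{f₁ > 0}`,
`p₁ log f₁` and `p₁ log f₂` are integrable (convention `0 · log 0 = 0`, automatic since
`Real.log 0 = 0`), and `∫ p₁ log f₂ dμ ≥ ∫ p₁ log f₁ dμ`, then
`log L₂ ≥ log L₁`, equivalently `L₂ ≥ L₁`. -/
theorem stmt_12 {Z : Type*} [MeasurableSpace Z] (μ : Measure Z)
    (f₁ f₂ : Z → ℝ) (hm₁ : Measurable f₁) (hm₂ : Measurable f₂)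
    (h₁0 : ∀ z, 0 ≤ f₁ z) (h₂0 : ∀ z, 0 ≤ f₂ z)
    (L₁ L₂ : ℝ) (hL₁ : L₁ = ∫ z, f₁ z ∂μ) (hL₂ : L₂ = ∫ z, f₂ z ∂μ)
    (hL₁pos : 0 < L₁) (hL₂pos : 0 < L₂)
    (p₁ : Z → ℝ) (hp₁ : p₁ = fun z => f₁ z / L₁)
    (hpos : ∀ᵐ z ∂μ, 0 < f₁ z → 0 < f₂ z)
    (hint1 : Integrable (fun z => p₁ z * Real.log (f₁ z)) μ)
    (hint2 : Integrable (fun z => p₁ z * Real.log (f₂ z)) μ)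
    (hQ : ∫ z, p₁ z * Real.log (f₁ z) ∂μ ≤ ∫ z, p₁ z * Real.log (f₂ z) ∂μ) :
    Real.log L₁ ≤ Real.log L₂ ∧ L₁ ≤ L₂ := by
  have i1 : Integrable f₁ μ := by
    by_contra h
    rw [integral_undef h] at hL₁
    exact hL₁pos.ne' hL₁
  have i2 : Integrable f₂ μ := by
    by_contra h
    rw [integral_undef h] at hL₂
    exact hL₂pos.ne' hL₂
  have key : ∫ z, (p₁ z * Real.log (f₂ z) - p₁ z * Real.log (f₁ z)) ∂μ
      ≤ ∫ z, (f₂ z - f₁ z) / L₁ ∂μ := by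
    apply integral_mono_ae (hint2.sub hint1) ((i2.sub i1).div_const L₁)
    filter_upwards [hpos] with z hz
    subst hp₁
    change f₁ z / L₁ * Real.log (f₂ z) - f₁ z / L₁ * Real.log (f₁ z) ≤ (f₂ z - f₁ z) / L₁
    rcases (h₁0 z).eq_or_lt with h | h
    · rw [← h]
      simpa using div_nonneg (h₂0 z) hL₁pos.le
    · have h2 := hz h
      have hl := Real.log_le_sub_one_of_pos (div_pos h2 h)
      rw [Real.log_div h2.ne' h.ne'] at hl
      have hm := mul_le_mul_of_nonneg_left hl h.le
      have e : f₁ z * (f₂ z / f₁ z - 1) = f₂ z - f₁ z := by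
        field_simp
      rw [e] at hm
      have := div_le_div_of_nonneg_right hm hL₁pos.le
      calc _ = f₁ z * (Real.log (f₂ z) - Real.log (f₁ z)) / L₁ := by ring
        _ ≤ _ := this
  rw [integral_sub hint2 hint1, integral_div, integral_sub i2 i1, ← hL₁, ← hL₂] at key
  have h0 : 0 ≤ (L₂ - L₁) / L₁ := by linarith
  have hle : L₁ ≤ L₂ := by
    have := mul_nonneg h0 hL₁pos.le
    rw [div_mul_cancel₀ _ hL₁pos.ne'] at this
    linarith
  exact ⟨Real.log_le_log hL₁pos hle, hle⟩
end
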